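/- Let A_1,…,A_d, B_1,…,B_d, E, F ⊂ M_n(F_q) and let N be the number of solutions to A_1B_1 + A_2B_2 + ⋯ + A_dB_d = E + F with A_i ∈ A_i, B_i ∈ B_i, E ∈ E, F ∈ F. Then |N − |E||F|∏_i|A_i||B_i| / q^{n²}| ≤ C·q^{dn² − (d−1)n/2 − 1/2}·√(|E||F|∏_i|A_i||B_i|) for some constant C independent of q and the sets. -/

import Mathlib

lemma aux_sum {G ι : Type} [AddCommGroup G] (χ : AddChar G ℂ) (s : Finset ι) (f : ι → G) :
    χ (∑ i ∈ s, f i) = ∏ i ∈ s, χ (f i) := by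
  classical
  induction s using Finset.induction_on with
  | empty => simp
  | insert a s ha ih => rw [Finset.sum_insert ha, Finset.prod_insert ha, AddChar.map_add_eq_mul, ih]

lemma aux_card (F : Type) [Field F] [Fintype F] (n : ℕ) :
    Fintype.card (Matrix (Fin n) (Fin n) F) = Fintype.card F ^ n ^ 2 := by
  rw [← Nat.card_eq_fintype_card]
  unfold Matrix
  rw [Nat.card_fun, Nat.card_fun]
  simp [← pow_mul, sq]

open Finset in
lemma aux_plancherel {G : Type} [AddCommGroup G] [Fintype G] (E : Finset G) :
    ∑ χ : AddChar G ℂ, ‖∑ e ∈ E, χ e‖ ^ 2 = (Fintype.card G : ℝ) * E.card := by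
  classical
  have h : ((∑ χ : AddChar G ℂ, ‖∑ e ∈ E, χ e‖ ^ 2 : ℝ) : ℂ) = (Fintype.card G : ℂ) * E.card := by
    push_cast
    have : ∀ χ : AddChar G ℂ, ((‖∑ e ∈ E, χ e‖ : ℂ)) ^ 2 = ∑ e ∈ E, ∑ e' ∈ E, χ (e - e') := by
      intro χ
      rw [← Complex.mul_conj', map_sum, Finset.sum_mul_sum]
      refine sum_congr rfl fun e _ => sum_congr rfl fun e' _ => ?_
      rw [← AddChar.map_neg_eq_conj, sub_eq_add_neg, AddChar.map_add_eq_mul]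
    simp_rw [this]
    rw [sum_comm]
    have : ∀ e ∈ E, ∑ χ : AddChar G ℂ, ∑ e' ∈ E, χ (e - e') = (Fintype.card G : ℂ) := by
      intro e he
      rw [sum_comm]
      simp_rw [AddChar.sum_apply_eq_ite, sub_eq_zero]
      simp [he]
    rw [sum_congr rfl this]
    simp [mul_comm]
  exact_mod_cast h

open Finset in
lemma aux_ideal {F : Type} [Field F] [Fintype F] {n : ℕ}
    (χ : AddChar (Matrix (Fin n) (Fin n) F) ℂ) (hχ : χ ≠ 0)
    (H : Finset (Matrix (Fin n) (Fin n) F)) (hH : ∀ X ∈ H, ∀ B, χ (X * B) = 1) :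
    H.card * Fintype.card F ^ n ≤ Fintype.card F ^ n ^ 2 := by
  classical
  obtain ⟨i, C, hi⟩ : ∃ i : Fin n, ∃ C, χ (Matrix.single i i (1 : F) * C) ≠ 1 := by
    by_contra! hcon
    apply hχ
    ext C
    have : C = ∑ i, Matrix.single i i (1 : F) * C := by
      rw [← Finset.sum_mul, Matrix.sum_single_one, one_mul]
    rw [this, aux_sum]
    simp [hcon]
  have hcard : (H ×ˢ (univ : Finset (Fin n → F))).card ≤
      (univ : Finset (Matrix (Fin n) (Fin n) F)).card := by
    refine Finset.card_le_card_of_injOn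
      (fun p => p.1 + Matrix.of (fun a b => if a = i then p.2 b else 0)) (by simp) ?_
    rintro ⟨X, v⟩ hX ⟨Y, w⟩ hY hXY
    simp only [coe_product, Set.mem_prod, mem_coe, mem_univ, and_true, coe_univ, Set.mem_univ] at hX hY hXY
    have hvw : v = w := by
      by_contra hne
      obtain ⟨j, hj⟩ := Function.ne_iff.mp hne
      apply hi
      have hj' : v j - w j ≠ 0 := sub_ne_zero.mpr hj
      have e : Matrix.single i i (1 : F) =
          (Y - X) * Matrix.single j i (v j - w j)⁻¹ := by
        have : Y - X = Matrix.of (fun a b => if a = i then v b - w b else 0) := by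
          ext a b
          have := congrFun (congrFun hXY a) b
          simp only [Matrix.add_apply, Matrix.of_apply, Matrix.sub_apply] at this ⊢
          split_ifs at this ⊢ <;> linear_combination -this
        rw [this]
        ext a b
        by_cases hb : b = i
        · subst hb
          by_cases ha : a = b
          · subst ha; simp [hj']
          · simp [ha, Ne.symm ha, Matrix.single_apply]
        · rw [Matrix.mul_single_apply_of_ne _ _ _ _ _ hb]
          simp [Matrix.single_apply, Ne.symm hb]
      rw [e, mul_assoc, sub_mul, AddChar.map_sub_eq_div, hH _ hX, hH _ hY, div_one]
    subst hvw
    simpa using hXY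
  rw [card_product, card_univ, card_univ, aux_card] at hcard
  simpa using hcard

open Finset in
lemma aux_bilin {F : Type} [Field F] [Fintype F] {n : ℕ}
    (χ : AddChar (Matrix (Fin n) (Fin n) F) ℂ) (hχ : χ ≠ 0)
    (A B : Finset (Matrix (Fin n) (Fin n) F)) :
    ‖∑ a ∈ A, ∑ b ∈ B, χ (a * b)‖ ^ 2 ≤
      (A.card * B.card : ℝ) * ((Fintype.card F : ℝ) ^ (2 * n ^ 2) / (Fintype.card F : ℝ) ^ n) := by
  classical
  set q := Fintype.card F with hq
  have hq0 : (0 : ℝ) < q := by exact_mod_cast Fintype.card_pos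
  set H : Finset (Matrix (Fin n) (Fin n) F) := univ.filter fun X => ∀ B, χ (X * B) = 1 with hH
  have hHc : (H.card : ℝ) ≤ (q : ℝ) ^ n ^ 2 / (q : ℝ) ^ n := by
    rw [le_div_iff₀ (by positivity)]
    exact_mod_cast aux_ideal χ hχ H (by simp [hH])
  have hM : (Fintype.card (Matrix (Fin n) (Fin n) F) : ℝ) = (q : ℝ) ^ n ^ 2 := by
    have : Fintype.card (Matrix (Fin n) (Fin n) F) = q ^ n ^ 2 := aux_card F n
    exact_mod_cast this
  have key : ∑ b, ‖∑ a ∈ A, χ (a * b)‖ ^ 2 ≤ A.card * (H.card * (q : ℝ) ^ n ^ 2) := by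
    have h : ((∑ b, ‖∑ a ∈ A, χ (a * b)‖ ^ 2 : ℝ) : ℂ) =
        ((∑ a ∈ A, ∑ a' ∈ A, if a - a' ∈ H then (q : ℝ) ^ n ^ 2 else 0 : ℝ) : ℂ) := by
      push_cast
      have : ∀ b, ((‖∑ a ∈ A, χ (a * b)‖ : ℂ)) ^ 2 =
          ∑ a ∈ A, ∑ a' ∈ A, χ ((a - a') * b) := by
        intro b
        rw [← Complex.mul_conj', map_sum, Finset.sum_mul_sum]
        refine sum_congr rfl fun e _ => sum_congr rfl fun e' _ => ?_
        rw [← AddChar.map_neg_eq_conj, sub_mul, sub_eq_add_neg, AddChar.map_add_eq_mul]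
      simp_rw [this]
      rw [sum_comm]
      refine sum_congr rfl fun a _ => ?_
      rw [sum_comm]
      refine sum_congr rfl fun a' _ => ?_
      have := AddChar.sum_eq_ite (χ.compAddMonoidHom (AddMonoidHom.mulLeft (a - a')))
      simp only [AddChar.compAddMonoidHom_apply, AddMonoidHom.coe_mulLeft] at this
      rw [this]
      have hiff : χ.compAddMonoidHom (AddMonoidHom.mulLeft (a - a')) = 0 ↔ a - a' ∈ H := by
        simp [hH, DFunLike.ext_iff]
      have hM' : (Fintype.card (Matrix (Fin n) (Fin n) F) : ℂ) = (q : ℂ) ^ n ^ 2 := by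
        exact_mod_cast hM
      simp only [hiff, hM']
      split_ifs <;> simp
    have h' := Complex.ofReal_injective h
    rw [h', ← nsmul_eq_mul]
    refine sum_le_card_nsmul _ _ _ fun a _ => ?_
    rw [← sum_filter, sum_const, nsmul_eq_mul]
    refine mul_le_mul_of_nonneg_right ?_ (by positivity)
    refine Nat.cast_le.mpr (card_le_card_of_injOn (fun a' => a - a') (by intro x; simp) ?_)
    intro x _ y _ hxy
    simpa using hxy
  calc ‖∑ a ∈ A, ∑ b ∈ B, χ (a * b)‖ ^ 2 = ‖∑ b ∈ B, ∑ a ∈ A, χ (a * b)‖ ^ 2 := by rw [sum_comm]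
    _ ≤ (∑ b ∈ B, ‖∑ a ∈ A, χ (a * b)‖) ^ 2 := by gcongr; exact norm_sum_le _ _
    _ ≤ B.card * ∑ b ∈ B, ‖∑ a ∈ A, χ (a * b)‖ ^ 2 := sq_sum_le_card_mul_sum_sq
    _ ≤ B.card * ∑ b, ‖∑ a ∈ A, χ (a * b)‖ ^ 2 := by
        gcongr
        exact subset_univ B
    _ ≤ B.card * (A.card * (H.card * (q : ℝ) ^ n ^ 2)) := by gcongr
    _ ≤ B.card * (A.card * (((q : ℝ) ^ n ^ 2 / (q : ℝ) ^ n) * (q : ℝ) ^ n ^ 2)) := by gcongr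
    _ = _ := by rw [two_mul, pow_add]; ring

open Finset in
lemma aux_count {F : Type} [Field F] [Fintype F] {n d : ℕ}
    (𝒜 ℬ : Fin d → Finset (Matrix (Fin n) (Fin n) F))
    (ℰ ℱ : Finset (Matrix (Fin n) (Fin n) F)) :
    ((Fintype.card F : ℂ) ^ n ^ 2) * (Nat.card {x : (Fin d → Matrix (Fin n) (Fin n) F) ×
              (Fin d → Matrix (Fin n) (Fin n) F) ×
              Matrix (Fin n) (Fin n) F × Matrix (Fin n) (Fin n) F //
            (∀ i, x.1 i ∈ 𝒜 i) ∧ (∀ i, x.2.1 i ∈ ℬ i) ∧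
              x.2.2.1 ∈ ℰ ∧ x.2.2.2 ∈ ℱ ∧
              ∑ i, x.1 i * x.2.1 i = x.2.2.1 + x.2.2.2} : ℂ) =
    ∑ χ : AddChar (Matrix (Fin n) (Fin n) F) ℂ,
      (∏ i, ∑ a ∈ 𝒜 i, ∑ b ∈ ℬ i, χ (a * b)) *
      ((starRingEnd ℂ (∑ e ∈ ℰ, χ e)) * (starRingEnd ℂ (∑ f ∈ ℱ, χ f))) := by
  classical
  have hM : (Fintype.card (Matrix (Fin n) (Fin n) F) : ℂ) = (Fintype.card F : ℂ) ^ n ^ 2 := by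
    have : Fintype.card (Matrix (Fin n) (Fin n) F) = Fintype.card F ^ n ^ 2 := aux_card F n
    exact_mod_cast this
  set P := Fintype.piFinset 𝒜 ×ˢ (Fintype.piFinset ℬ ×ˢ (ℰ ×ˢ ℱ)) with hP
  have h1 : (Nat.card {x : (Fin d → Matrix (Fin n) (Fin n) F) ×
              (Fin d → Matrix (Fin n) (Fin n) F) ×
              Matrix (Fin n) (Fin n) F × Matrix (Fin n) (Fin n) F //
            (∀ i, x.1 i ∈ 𝒜 i) ∧ (∀ i, x.2.1 i ∈ ℬ i) ∧
              x.2.2.1 ∈ ℰ ∧ x.2.2.2 ∈ ℱ ∧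
              ∑ i, x.1 i * x.2.1 i = x.2.2.1 + x.2.2.2}) =
      (P.filter fun x => ∑ i, x.1 i * x.2.1 i = x.2.2.1 + x.2.2.2).card := by
    rw [Nat.card_eq_fintype_card, Fintype.card_subtype]
    congr 1
    ext x
    simp [hP, Fintype.mem_piFinset, and_assoc]
  rw [h1, ← hM, card_filter]
  push_cast
  rw [mul_sum]
  have h2 : ∀ x ∈ P, (Fintype.card (Matrix (Fin n) (Fin n) F) : ℂ) *
      (if ∑ i, x.1 i * x.2.1 i = x.2.2.1 + x.2.2.2 then 1 else 0) =
      ∑ χ : AddChar (Matrix (Fin n) (Fin n) F) ℂ,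
        (∏ i, χ (x.1 i * x.2.1 i)) *
          ((starRingEnd ℂ (χ x.2.2.1)) * (starRingEnd ℂ (χ x.2.2.2))) := by
    intro x _
    have := AddChar.sum_apply_eq_ite (∑ i, x.1 i * x.2.1 i - (x.2.2.1 + x.2.2.2))
    simp only [sub_eq_zero] at this
    rw [mul_ite, mul_one, mul_zero, ← this]
    refine sum_congr rfl fun χ _ => ?_
    rw [sub_eq_add_neg, neg_add, AddChar.map_add_eq_mul, AddChar.map_add_eq_mul, aux_sum,
      AddChar.map_neg_eq_conj, AddChar.map_neg_eq_conj]
  rw [sum_congr rfl h2, sum_comm]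
  refine sum_congr rfl fun χ _ => ?_
  have h3 : ∏ i, ∑ a ∈ 𝒜 i, ∑ b ∈ ℬ i, χ (a * b) =
      ∑ a ∈ Fintype.piFinset 𝒜, ∑ b ∈ Fintype.piFinset ℬ, ∏ i, χ (a i * b i) := by
    rw [prod_univ_sum]
    refine sum_congr rfl fun a _ => ?_
    rw [prod_univ_sum]
  rw [h3, map_sum, map_sum, sum_mul_sum, hP, sum_product, sum_mul]
  refine sum_congr rfl fun a _ => ?_
  rw [sum_product, sum_mul]
  refine sum_congr rfl fun b _ => ?_
  rw [sum_product, mul_sum]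
  refine sum_congr rfl fun e _ => ?_
  rw [mul_sum]

/-- Main theorem: for sets 𝒜_i, ℬ_i, ℰ, ℱ ⊂ M_n(F_q), the number N of solutions to
Σ A_iB_i = E + F satisfies
|N − |ℰ||ℱ|∏|𝒜_i||ℬ_i|/q^{n²}| ≤ C·q^{dn²−(d−1)n/2−1/2}·√(|ℰ||ℱ|∏|𝒜_i||ℬ_i|). -/
theorem stmt_17 (d n : ℕ) (hd : 1 ≤ d) (hn : 2 ≤ n) :
    ∃ C : ℝ, 0 < C ∧
      ∀ (q : ℕ) (F : Type) [Field F] [Fintype F], Fintype.card F = q → Odd q →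
        ∀ (𝒜 ℬ : Fin d → Finset (Matrix (Fin n) (Fin n) F))
          (ℰ ℱ : Finset (Matrix (Fin n) (Fin n) F)),
        |(Nat.card {x : (Fin d → Matrix (Fin n) (Fin n) F) ×
              (Fin d → Matrix (Fin n) (Fin n) F) ×
              Matrix (Fin n) (Fin n) F × Matrix (Fin n) (Fin n) F //
            (∀ i, x.1 i ∈ 𝒜 i) ∧ (∀ i, x.2.1 i ∈ ℬ i) ∧
              x.2.2.1 ∈ ℰ ∧ x.2.2.2 ∈ ℱ ∧
              ∑ i, x.1 i * x.2.1 i = x.2.2.1 + x.2.2.2} : ℝ) -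
            (ℰ.card : ℝ) * ℱ.card * (∏ i, ((𝒜 i).card : ℝ) * (ℬ i).card) / (q : ℝ) ^ n ^ 2| ≤
          C * Real.sqrt ((q : ℝ) ^ (2 * d * n ^ 2 - (d - 1) * n - 1)) *
            Real.sqrt ((ℰ.card : ℝ) * ℱ.card * ∏ i, ((𝒜 i).card : ℝ) * (ℬ i).card) := by
  classical
  refine ⟨1, one_pos, ?_⟩
  intro q F _ _ hq _ 𝒜 ℬ ℰ ℱ
  have hc := aux_count 𝒜 ℬ ℰ ℱ
  rw [hq] at hc
  generalize hN : Nat.card {x : (Fin d → Matrix (Fin n) (Fin n) F) ×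
              (Fin d → Matrix (Fin n) (Fin n) F) ×
              Matrix (Fin n) (Fin n) F × Matrix (Fin n) (Fin n) F //
            (∀ i, x.1 i ∈ 𝒜 i) ∧ (∀ i, x.2.1 i ∈ ℬ i) ∧
              x.2.2.1 ∈ ℰ ∧ x.2.2.2 ∈ ℱ ∧
              ∑ i, x.1 i * x.2.1 i = x.2.2.1 + x.2.2.2} = N at hc ⊢
  have hq1 : (1 : ℝ) ≤ q := by
    rw [← hq]; exact_mod_cast Fintype.card_pos (α := F)
  have hq0 : (0 : ℝ) < q := by linarith
  set P : ℝ := ∏ i, ((𝒜 i).card : ℝ) * (ℬ i).card with hP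
  have hP0 : 0 ≤ P := Finset.prod_nonneg fun i _ => by positivity
  set L : ℝ := (q : ℝ) ^ (2 * n ^ 2) / (q : ℝ) ^ n with hL
  have hL0 : 0 ≤ L := by positivity
  clear_value P L
  set R : ℂ := ∑ χ ∈ (Finset.univ : Finset (AddChar (Matrix (Fin n) (Fin n) F) ℂ)).erase 0,
      (∏ i, ∑ a ∈ 𝒜 i, ∑ b ∈ ℬ i, χ (a * b)) *
      ((starRingEnd ℂ (∑ e ∈ ℰ, χ e)) * (starRingEnd ℂ (∑ f ∈ ℱ, χ f))) with hR
  have hsplit : (q : ℂ) ^ n ^ 2 * N = ((ℰ.card * ℱ.card * P : ℝ) : ℂ) + R := by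
    rw [hc, ← Finset.add_sum_erase _ _ (Finset.mem_univ 0), ← hR]
    congr 1
    simp [hP]
    ring
  have hRe : R = (((q : ℝ) ^ n ^ 2 * N - ℰ.card * ℱ.card * P : ℝ) : ℂ) := by
    rw [Complex.ofReal_sub, ← sub_eq_iff_eq_add'.mpr hsplit]
    push_cast
    ring
  have hK : ∀ χ : AddChar (Matrix (Fin n) (Fin n) F) ℂ, χ ≠ 0 →
      ‖∏ i, ∑ a ∈ 𝒜 i, ∑ b ∈ ℬ i, χ (a * b)‖ ≤ √(P * L ^ d) := by
    intro χ hχ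
    apply Real.le_sqrt_of_sq_le
    rw [norm_prod, ← Finset.prod_pow]
    have : P * L ^ d = ∏ i, (((𝒜 i).card : ℝ) * (ℬ i).card) * L := by
      rw [Finset.prod_mul_distrib (g := fun _ => L)]
      simp [hP]
    rw [this]
    refine Finset.prod_le_prod (fun i _ => by positivity) fun i _ => ?_
    have := aux_bilin χ hχ (𝒜 i) (ℬ i)
    rwa [hq, ← hL] at this
  have hcardM : (Fintype.card (Matrix (Fin n) (Fin n) F) : ℝ) = (q : ℝ) ^ n ^ 2 := by
    rw [aux_card, hq]; push_cast; rfl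
  have hCS : ∑ χ : AddChar (Matrix (Fin n) (Fin n) F) ℂ, ‖∑ e ∈ ℰ, χ e‖ * ‖∑ f ∈ ℱ, χ f‖ ≤
      (q : ℝ) ^ n ^ 2 * √(ℰ.card * ℱ.card) := by
    have h := Real.sum_mul_le_sqrt_mul_sqrt Finset.univ
      (fun χ : AddChar (Matrix (Fin n) (Fin n) F) ℂ => ‖∑ e ∈ ℰ, χ e‖)
      (fun χ : AddChar (Matrix (Fin n) (Fin n) F) ℂ => ‖∑ f ∈ ℱ, χ f‖)
    refine h.trans (le_of_eq ?_)
    rw [aux_plancherel, aux_plancherel, hcardM, ← Real.sqrt_mul (by positivity),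
      show (q : ℝ) ^ n ^ 2 * ℰ.card * ((q : ℝ) ^ n ^ 2 * ℱ.card) =
        ((q : ℝ) ^ n ^ 2) ^ 2 * (ℰ.card * ℱ.card) by ring,
      Real.sqrt_mul (by positivity), Real.sqrt_sq (by positivity)]
  have hRn : ‖R‖ ≤ √(P * L ^ d) * ((q : ℝ) ^ n ^ 2 * √(ℰ.card * ℱ.card)) := by
    calc ‖R‖ ≤ ∑ χ ∈ (Finset.univ : Finset (AddChar (Matrix (Fin n) (Fin n) F) ℂ)).erase 0,
          √(P * L ^ d) * (‖∑ e ∈ ℰ, χ e‖ * ‖∑ f ∈ ℱ, χ f‖) := by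
          refine norm_sum_le_of_le _ fun χ hχ => ?_
          rw [norm_mul, norm_mul, RCLike.norm_conj, RCLike.norm_conj]
          exact mul_le_mul_of_nonneg_right (hK χ (Finset.ne_of_mem_erase hχ)) (by positivity)
      _ ≤ ∑ χ : AddChar (Matrix (Fin n) (Fin n) F) ℂ,
          √(P * L ^ d) * (‖∑ e ∈ ℰ, χ e‖ * ‖∑ f ∈ ℱ, χ f‖) :=
          Finset.sum_le_sum_of_subset_of_nonneg (Finset.erase_subset _ _)
            fun _ _ _ => by positivity
      _ ≤ _ := by
          rw [← Finset.mul_sum]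
          gcongr
  rw [hRe, Complex.norm_real, Real.norm_eq_abs] at hRn
  have hQ : (0 : ℝ) < (q : ℝ) ^ n ^ 2 := by positivity
  have hmain : |(N : ℝ) - ℰ.card * ℱ.card * P / (q : ℝ) ^ n ^ 2| ≤
      √(P * L ^ d) * √(ℰ.card * ℱ.card) := by
    have e : (N : ℝ) - ℰ.card * ℱ.card * P / (q : ℝ) ^ n ^ 2 =
        ((q : ℝ) ^ n ^ 2 * N - ℰ.card * ℱ.card * P) / (q : ℝ) ^ n ^ 2 := by
      field_simp
    rw [e, abs_div, abs_of_pos hQ, div_le_iff₀ hQ]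
    linarith
  refine hmain.trans ?_
  rw [one_mul, Real.sqrt_mul hP0, Real.sqrt_mul (by positivity) P]
  have hLd : L ^ d ≤ (q : ℝ) ^ (2 * d * n ^ 2 - (d - 1) * n - 1) := by
    rw [hL, div_pow, div_le_iff₀ (by positivity), ← pow_mul, ← pow_mul, ← pow_add]
    apply pow_le_pow_right₀ hq1
    obtain ⟨k, rfl⟩ : ∃ k, d = k + 1 := ⟨d - 1, by omega⟩
    have e1 : 2 * n ^ 2 * (k + 1) = 2 * (k + 1) * n ^ 2 := by ring
    have e2 : n * (k + 1) = k * n + n := by ring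
    rw [e1, e2, Nat.add_sub_cancel]
    omega
  have := Real.sqrt_le_sqrt hLd
  calc √P * √(L ^ d) * √(ℰ.card * ℱ.card) = √(L ^ d) * (√(ℰ.card * ℱ.card) * √P) := by ring
    _ ≤ _ := by gcongr
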